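/- Suppose there exist a map ū : ℝ^d → ℝ^d with ‖ū(z)‖_2 ≤ 1 for all z ∈ ℝ^d and a constant γ ∈ (0,1] such that y_i ∫_{ℝ^d} σ'(⟨z, x_i⟩) · ⟨ū(z), x_i⟩ dμ_N(z) ≥ γ for all i ∈ [n], where μ_N is the standard normal distribution on ℝ^d. If m ≥ 32 log(2n/δ)/γ², then with probability at least 1 − δ over the Gaussian initialization of the two-layer network, there exists a matrix U ∈ ℝ^{m×d} with ‖U‖_F ≤ 2.2 such that y_i ⟨∇_{W_1} f_{W^(0)}(x_i), U⟩ ≥ m^{1/2} γ / 4 for all i ∈ [n]. -/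

import Mathlib

open MeasureTheory ProbabilityTheory Real
open scoped BigOperators ENNReal NNReal

noncomputable section

namespace TwoLayer

/-- ReLU activation. -/
def relu (z : ℝ) : ℝ := max z 0

/-- Formal derivative of the ReLU: `σ'(z) = 1{z > 0}`. -/
def relu' (z : ℝ) : ℝ := if 0 < z then 1 else 0

/-- Cross-entropy loss `ℓ(z) = log(1 + exp(-z))`. -/
def xent (z : ℝ) : ℝ := Real.log (1 + Real.exp (-z))

/-- Two-layer ReLU network `f_W(x) = √m · W₂ σ(W₁ x)`. -/
def net2 (m d : ℕ) (W1 : Fin m → Fin d → ℝ) (W2 : Fin m → ℝ) (x : Fin d → ℝ) : ℝ :=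
  Real.sqrt m * ∑ j : Fin m, W2 j * relu (∑ k : Fin d, W1 j k * x k)

/-- Formal gradient w.r.t. the first layer: the `j`-th row is
`√m · w₂ⱼ · σ'(⟨w₁ⱼ, x⟩) · xᵀ`. -/
def grad1 (m d : ℕ) (W1 : Fin m → Fin d → ℝ) (W2 : Fin m → ℝ) (x : Fin d → ℝ) :
    Fin m → Fin d → ℝ :=
  fun j k => Real.sqrt m * W2 j * relu' (∑ k' : Fin d, W1 j k' * x k') * x k

/-- Formal gradient w.r.t. the second layer: `√m · σ(W₁ x)`. -/
def grad2 (m d : ℕ) (W1 : Fin m → Fin d → ℝ) (x : Fin d → ℝ) : Fin m → ℝ :=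
  fun j => Real.sqrt m * relu (∑ k : Fin d, W1 j k * x k)

/-- NTRF model `F_{W⁰,W}(x) = f_{W⁰}(x) + ⟨∇f_{W⁰}(x), W − W⁰⟩` for the two-layer
network. -/
def ntrf2 (m d : ℕ) (W0 : (Fin m → Fin d → ℝ) × (Fin m → ℝ))
    (W1 : Fin m → Fin d → ℝ) (W2 : Fin m → ℝ) (x : Fin d → ℝ) : ℝ :=
  net2 m d W0.1 W0.2 x +
    (∑ j : Fin m, ∑ k : Fin d, grad1 m d W0.1 W0.2 x j k * (W1 j k - W0.1 j k)) +
    ∑ j : Fin m, grad2 m d W0.1 x j * (W2 j - W0.2 j)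

/-- Gaussian initialization of the two-layer network: entries of `W₁⁰` are i.i.d.
`N(0, 2/m)`, entries of `W₂⁰` are i.i.d. `N(0, 1/m)`. -/
def init2 (m d : ℕ) : Measure ((Fin m → Fin d → ℝ) × (Fin m → ℝ)) :=
  (Measure.pi fun _ : Fin m =>
      Measure.pi fun _ : Fin d => gaussianReal 0 (2 * (m : ℝ≥0)⁻¹)).prod
    (Measure.pi fun _ : Fin m => gaussianReal 0 (m : ℝ≥0)⁻¹)

/-- Standard normal distribution on `ℝ^d`. -/
def stdNormal (d : ℕ) : Measure (Fin d → ℝ) :=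
  Measure.pi fun _ : Fin d => gaussianReal 0 1

end TwoLayer

open TwoLayer

theorem aux_hoeffding {α : Type*} [MeasurableSpace α] (P : Measure α) [IsProbabilityMeasure P]
    (m : ℕ) (F : α → ℝ) (hF : AEMeasurable F P) (hb : ∀ a, |F a| ≤ 1) (ε : ℝ) (hε : 0 ≤ ε)
    (hm : 1 ≤ m) :
    (Measure.pi fun _ : Fin m => P).real {ω | ∑ j, F (ω j) ≤ m * ((∫ a, F a ∂P) - ε)} ≤
      Real.exp (-(m * ε ^ 2 / 2)) := by
  set M := ∫ a, F a ∂P with hM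
  set μ := Measure.pi fun _ : Fin m => P with hμ
  have hind : iIndepFun (fun (j : Fin m) (ω : Fin m → α) => M - F (ω j)) μ :=
    iIndepFun_pi (X := fun _ a => M - F a) (fun _ => hF.const_sub M)
  have hsub : ∀ j ∈ (Finset.univ : Finset (Fin m)),
      HasSubgaussianMGF (fun ω : Fin m → α => M - F (ω j)) 1 μ := by
    intro j _
    have hmeas : AEMeasurable (fun ω : Fin m → α => - F (ω j)) μ :=
      (hF.comp_quasiMeasurePreserving
        (measurePreserving_eval (fun _ : Fin m => P) j).quasiMeasurePreserving).neg
    have h := hasSubgaussianMGF_of_mem_Icc (a := -1) (b := 1) hmeas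
      (Filter.Eventually.of_forall fun ω => by
        have := abs_le.1 (hb (ω j)); constructor <;> linarith)
    have hint : ∫ ω : Fin m → α, - F (ω j) ∂μ = - M := by
      rw [integral_neg, hμ, integral_comp_eval (μ := fun _ : Fin m => P) (f := F)
        hF.aestronglyMeasurable]
    have hc : ((‖(1:ℝ) - (-1)‖₊ / 2) ^ 2 : ℝ≥0) = 1 := by
      ext; push_cast; norm_num
    rw [hint, hc] at h
    convert h using 2 with ω
    ring
  have h := HasSubgaussianMGF.measure_sum_ge_le_of_iIndepFun hind hsub
    (ε := m * ε) (by positivity)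
  have hmp : (0:ℝ) < m := by exact_mod_cast hm
  have e1 : {ω : Fin m → α | ∑ j, F (ω j) ≤ m * (M - ε)} =
      {ω | m * ε ≤ ∑ j, (M - F (ω j))} := by
    ext ω
    simp only [Set.mem_ofPred_eq, Finset.sum_sub_distrib, Finset.sum_const, Finset.card_univ,
      Fintype.card_fin, nsmul_eq_mul]
    constructor <;> intro h <;> linarith
  rw [e1]
  refine h.trans (le_of_eq ?_)
  congr 1
  simp only [Finset.sum_const, Finset.card_univ, Fintype.card_fin, nsmul_eq_mul]
  push_cast
  field_simp

theorem aux_cos (v : ℝ≥0) (t : ℝ) :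
    ∫ x, Real.cos (t * x) ∂(gaussianReal 0 v) = Real.exp (-(v * t ^ 2 / 2)) := by
  have h := charFun_gaussianReal (μ := 0) (v := v) t
  rw [charFun_apply_real] at h
  have hi : Integrable (fun x : ℝ => Complex.exp (t * x * Complex.I)) (gaussianReal 0 v) := by
    refine Integrable.of_bound (by fun_prop) 1 (Filter.Eventually.of_forall fun x => ?_)
    rw [← Complex.ofReal_mul, Complex.norm_exp_ofReal_mul_I]
  have h2 := congrArg Complex.re h
  have h3 := integral_re hi
  simp only [RCLike.re_to_complex] at h3
  rw [← h3] at h2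
  have e1 : ∀ x : ℝ, (Complex.exp (t * x * Complex.I)).re = Real.cos (t * x) := by
    intro x
    rw [← Complex.ofReal_mul, Complex.exp_ofReal_mul_I_re]
  simp only [e1] at h2
  rw [h2]
  have e2 : ((t:ℂ) * ((0:ℝ):ℂ) * Complex.I - (v:ℂ) * (t:ℂ) ^ 2 / 2) = ((-(v * t ^ 2 / 2) : ℝ) : ℂ) := by
    push_cast; simp
  rw [e2, Complex.exp_ofReal_re]

theorem aux_sin (m : ℕ) (hm : 1 ≤ m) :
    43 / 100 ≤ ∫ x, Real.sin (Real.sqrt m * x) ^ 2 ∂(gaussianReal 0 (m : ℝ≥0)⁻¹) := by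
  have hmp : (0:ℝ) < m := by exact_mod_cast hm
  have e : ∀ x : ℝ, Real.sin (Real.sqrt m * x) ^ 2 =
      1 / 2 - (1 / 2) * Real.cos ((2 * Real.sqrt m) * x) := by
    intro x
    rw [mul_assoc, Real.cos_two_mul, Real.sin_sq]; ring
  simp only [e]
  have hi : Integrable (fun x : ℝ => Real.cos ((2 * Real.sqrt m) * x))
      (gaussianReal 0 (m : ℝ≥0)⁻¹) :=
    Integrable.of_bound (by fun_prop) 1
      (Filter.Eventually.of_forall fun x => Real.abs_cos_le_one _)
  rw [integral_sub (integrable_const _) (hi.const_mul _), integral_const_mul, aux_cos]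
  have e2 : (((m : ℝ≥0)⁻¹ : ℝ≥0) : ℝ) * (2 * Real.sqrt m) ^ 2 / 2 = 2 := by
    push_cast
    rw [mul_pow, Real.sq_sqrt hmp.le]; field_simp
  rw [e2]
  have h1 := Real.exp_one_gt_d9
  have h2 : Real.exp (-2) ≤ 14 / 100 := by
    rw [Real.exp_neg, show (2:ℝ) = 1 + 1 by norm_num, Real.exp_add]
    rw [inv_le_comm₀ (by positivity) (by norm_num)]
    nlinarith
  simp
  linarith

theorem aux_scale (m d : ℕ) (hm : 1 ≤ m) :
    MeasurePreserving (fun (w : Fin d → ℝ) k => Real.sqrt (m / 2) * w k)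
      (Measure.pi fun _ : Fin d => gaussianReal 0 (2 * (m : ℝ≥0)⁻¹)) (stdNormal d) := by
  have hmp : (0:ℝ) < m := by exact_mod_cast hm
  refine measurePreserving_pi (f := fun _ x => Real.sqrt (m / 2) * x) _ _ fun _ => ⟨by fun_prop, ?_⟩
  rw [gaussianReal_map_const_mul]
  congr 1
  · simp
  · ext
    push_cast
    change Real.sqrt (m / 2) ^ 2 * (2 * (m:ℝ)⁻¹) = 1
    rw [Real.sq_sqrt (by positivity)]; field_simp

theorem aux_relu' (s x : ℝ) (hs : 0 < s) : relu' (s * x) = relu' x := by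
  unfold relu'
  simp [hs]

theorem aux_g (b : ℝ) : (Real.sin b ^ 2 / b) ^ 2 ≤ 1 := by
  by_cases hb : b = 0
  · simp [hb]
  have h1 : Real.sin b ^ 2 ≤ b ^ 2 := by
    rw [sq_le_sq]; exact Real.abs_sin_le_abs
  have h2 : Real.sin b ^ 2 ≤ 1 := Real.sin_sq_le_one b
  rw [div_pow, div_le_one (by positivity)]
  nlinarith [sq_nonneg (Real.sin b)]

/-- linear separability of the first-layer gradients at
initialization, inside the proof of Proposition 4.2. Under the shallow NTK
separability assumption with `γ ∈ (0,1]`, if `m ≥ 32 log(2n/δ)/γ²`, then with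
probability at least `1 − δ` over the Gaussian initialization there is a matrix
`U ∈ ℝ^{m×d}` with `‖U‖_F ≤ 2.2` such that
`y_i ⟨∇_{W₁} f_{W⁰}(x_i), U⟩ ≥ √m γ/4` for all `i ∈ [n]`. -/
theorem first_layer_gradient_separability
    (m d n : ℕ) (hm : 1 ≤ m) (hd : 1 ≤ d) (hn : 1 ≤ n)
    (X : Fin n → Fin d → ℝ) (Y : Fin n → ℝ) (γ δ : ℝ)
    (ubar : (Fin d → ℝ) → (Fin d → ℝ))
    (hX : ∀ i, ∑ k, (X i k) ^ 2 = 1)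
    (hY : ∀ i, Y i = 1 ∨ Y i = -1)
    (hγ : 0 < γ) (hγ1 : γ ≤ 1) (hδ : 0 < δ)
    (hubar : ∀ z, Real.sqrt (∑ k, (ubar z k) ^ 2) ≤ 1)
    (hsep : ∀ i, γ ≤ Y i *
      ∫ z, relu' (∑ k, z k * X i k) * (∑ k, ubar z k * X i k) ∂(stdNormal d))
    (hwidth : 32 * Real.log (2 * (n : ℝ) / δ) / γ ^ 2 ≤ (m : ℝ)) :
    ENNReal.ofReal (1 - δ) ≤
      init2 m d
        {W0 | ∃ U : Fin m → Fin d → ℝ,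
          Real.sqrt (∑ j, ∑ k, (U j k) ^ 2) ≤ 2.2 ∧
          ∀ i, Real.sqrt m * γ / 4 ≤
            Y i * ∑ j, ∑ k, grad1 m d W0.1 W0.2 (X i) j k * U j k} := by
  classical
  have hmp : (0:ℝ) < m := by exact_mod_cast hm
  have hnp : (0:ℝ) < n := by exact_mod_cast hn
  set s := Real.sqrt m with hs
  have hsp : 0 < s := Real.sqrt_pos.2 hmp
  have hss : s * s = m := Real.mul_self_sqrt hmp.le
  set r := Real.sqrt (m / 2) with hr
  have hrp : 0 < r := Real.sqrt_pos.2 (by positivity)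
  have hub : ∀ z, ∑ k, (ubar z k) ^ 2 ≤ 1 := fun z => by
    have := hubar z
    rwa [Real.sqrt_le_one] at this
  let H : Fin n → (Fin d → ℝ) → ℝ := fun i z =>
    relu' (∑ k, z k * X i k) * (∑ k, ubar z k * X i k)
  have hYabs : ∀ i, |Y i| = 1 := fun i => by rcases hY i with h | h <;> simp [h]
  have hHabs : ∀ i z, |H i z| ≤ 1 := by
    intro i z
    have h1 : |relu' (∑ k, z k * X i k)| ≤ 1 := by
      unfold relu'; split_ifs <;> simp
    have h2 : |∑ k, ubar z k * X i k| ≤ 1 := by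
      rw [← sq_le_one_iff_abs_le_one]
      refine (Finset.sum_mul_sq_le_sq_mul_sq _ _ _).trans ?_
      rw [hX i, mul_one]; exact hub z
    simp only [H, abs_mul]
    exact mul_le_one₀ h1 (abs_nonneg _) h2
  have hHint : ∀ i, Integrable (H i) (stdNormal d) := by
    intro i
    apply Integrable.of_integral_ne_zero
    intro h0
    have := hsep i
    simp only [H] at h0
    rw [h0] at this
    linarith
  let P1 : Measure (Fin d → ℝ) := Measure.pi fun _ : Fin d => gaussianReal 0 (2 * (m : ℝ≥0)⁻¹)
  let P2 : Measure ℝ := gaussianReal 0 (m : ℝ≥0)⁻¹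
  have hsc : MeasurePreserving (fun (w : Fin d → ℝ) k => r * w k) P1 (stdNormal d) :=
    aux_scale m d hm
  let G : Fin n → (Fin d → ℝ) → ℝ := fun i w => Y i * H i (fun k => r * w k)
  have hGm : ∀ i, AEMeasurable (G i) P1 := fun i =>
    ((hHint i).aestronglyMeasurable.aemeasurable.comp_quasiMeasurePreserving
      hsc.quasiMeasurePreserving).const_mul _
  have hGi : ∀ i, γ ≤ ∫ w, G i w ∂P1 := by
    intro i
    simp only [G]
    rw [integral_const_mul]
    have := integral_map (μ := P1) (φ := fun (w : Fin d → ℝ) k => r * w k) (f := H i)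
      hsc.measurable.aemeasurable (by rw [hsc.map_eq]; exact (hHint i).aestronglyMeasurable)
    rw [← this, hsc.map_eq]
    exact hsep i
  let F : Fin n → (Fin d → ℝ) × ℝ → ℝ := fun i p => G i p.1 * Real.sin (s * p.2) ^ 2
  have hFm : ∀ i, AEMeasurable (F i) (P1.prod P2) := by
    intro i
    refine AEMeasurable.mul ?_ (by fun_prop)
    exact (hGm i).comp_quasiMeasurePreserving Measure.quasiMeasurePreserving_fst
  have hFb : ∀ i p, |F i p| ≤ 1 := by
    intro i p
    simp only [F, G, abs_mul, hYabs, one_mul]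
    refine mul_le_one₀ (hHabs _ _) (abs_nonneg _) ?_
    rw [abs_of_nonneg (sq_nonneg _)]
    exact Real.sin_sq_le_one _
  have hFi : ∀ i, 43 / 100 * γ ≤ ∫ p, F i p ∂(P1.prod P2) := by
    intro i
    have := integral_prod_mul (μ := P1) (ν := P2) (G i) (fun x => Real.sin (s * x) ^ 2)
    simp only [F]
    rw [this]
    have h1 : 43 / 100 ≤ ∫ x, Real.sin (s * x) ^ 2 ∂P2 := aux_sin m hm
    have h2 := hGi i
    nlinarith
  let Q := Measure.pi fun _ : Fin m => P1.prod P2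
  let B : Fin n → Set (Fin m → (Fin d → ℝ) × ℝ) := fun i =>
    {ω | ∑ j, F i (ω j) ≤ m * ((∫ a, F i a ∂(P1.prod P2)) - γ / 4)}
  have hB : ∀ i, Q (B i) ≤ ENNReal.ofReal (δ / (2 * n)) := by
    intro i
    have h := aux_hoeffding (P1.prod P2) m (F i) (hFm i) (hFb i) (γ / 4) (by positivity) hm
    have h2 : Real.exp (-(m * (γ / 4) ^ 2 / 2)) ≤ δ / (2 * n) := by
      rw [div_le_iff₀ (by positivity)] at hwidth
      have : Real.exp (-(m * (γ / 4) ^ 2 / 2)) ≤ Real.exp (- Real.log (2 * n / δ)) := by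
        apply Real.exp_le_exp.2
        nlinarith
      refine this.trans (le_of_eq ?_)
      rw [Real.exp_neg, Real.exp_log (by positivity), inv_div]
    rw [← ENNReal.ofReal_toReal (measure_ne_top Q (B i))]
    exact ENNReal.ofReal_le_ofReal (h.trans h2)
  have hmap := measurePreserving_arrowProdEquivProdArrow (Fin d → ℝ) ℝ (Fin m)
    (fun _ => P1) (fun _ => P2)
  set S := {W0 : (Fin m → Fin d → ℝ) × (Fin m → ℝ) | ∃ U : Fin m → Fin d → ℝ,
          Real.sqrt (∑ j, ∑ k, (U j k) ^ 2) ≤ 2.2 ∧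
          ∀ i, s * γ / 4 ≤
            Y i * ∑ j, ∑ k, grad1 m d W0.1 W0.2 (X i) j k * U j k} with hS
  have hinit : init2 m d S =
      Q ((MeasurableEquiv.arrowProdEquivProdArrow (Fin d → ℝ) ℝ (Fin m)) ⁻¹' S) := by
    rw [← MeasurableEquiv.map_apply, hmap.map_eq]
    rfl
  rw [hinit]
  set S' := (MeasurableEquiv.arrowProdEquivProdArrow (Fin d → ℝ) ℝ (Fin m)) ⁻¹' S with hS'
  have hsub : S'ᶜ ⊆ ⋃ i, B i := by
    intro ω hω
    by_contra hcon
    apply hω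
    simp only [Set.mem_iUnion, not_exists, B, Set.mem_ofPred_eq, not_le] at hcon
    change ∃ U : Fin m → Fin d → ℝ,
          Real.sqrt (∑ j, ∑ k, (U j k) ^ 2) ≤ 2.2 ∧
          ∀ i, s * γ / 4 ≤
            Y i * ∑ j, ∑ k, grad1 m d (fun j => (ω j).1) (fun j => (ω j).2) (X i) j k * U j k
    refine ⟨fun j k => 2.2 / s * (Real.sin (s * (ω j).2) ^ 2 / (s * (ω j).2)) *
      ubar (fun k => r * (ω j).1 k) k, ?_, ?_⟩
    · rw [Real.sqrt_le_left (by norm_num)]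
      calc _ ≤ ∑ j : Fin m, (2.2 / s) ^ 2 := by
            refine Finset.sum_le_sum fun j _ => ?_
            simp only [mul_pow _ _ 2]
            rw [← Finset.mul_sum]
            have h1 := aux_g (s * (ω j).2)
            have h2 := hub (fun k => r * (ω j).1 k)
            rw [mul_assoc]
            refine mul_le_of_le_one_right (by positivity) ?_
            exact mul_le_one₀ h1 (Finset.sum_nonneg fun _ _ => sq_nonneg _) h2
        _ = 2.2 ^ 2 := by
            simp only [Finset.sum_const, Finset.card_univ, Fintype.card_fin, nsmul_eq_mul]
            rw [div_pow, sq s, hss]; field_simp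
    · intro i
      have key : Y i * ∑ j, ∑ k, grad1 m d (fun j => (ω j).1) (fun j => (ω j).2) (X i) j k *
          (2.2 / s * (Real.sin (s * (ω j).2) ^ 2 / (s * (ω j).2)) *
            ubar (fun k => r * (ω j).1 k) k) = 2.2 / s * ∑ j, F i (ω j) := by
        rw [Finset.mul_sum, Finset.mul_sum]
        refine Finset.sum_congr rfl fun j _ => ?_
        have hre : ∑ k, (r * (ω j).1 k) * X i k = r * ∑ k, (ω j).1 k * X i k := by
          rw [Finset.mul_sum]; exact Finset.sum_congr rfl fun _ _ => by ring
        simp only [F, G, H, grad1, hre, aux_relu' _ _ hrp, ← hs]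
        have hb : s * (ω j).2 * (Real.sin (s * (ω j).2) ^ 2 / (s * (ω j).2)) =
            Real.sin (s * (ω j).2) ^ 2 := by
          by_cases h0 : s * (ω j).2 = 0
          · simp [h0]
          · exact mul_div_cancel₀ _ h0
        generalize Real.sin (s * (ω j).2) ^ 2 / (s * (ω j).2) = q at hb ⊢
        rw [← hb]
        simp only [Finset.mul_sum, Finset.sum_mul]
        refine Finset.sum_congr rfl fun k _ => ?_
        ring
      rw [key]
      have h1 := hcon i
      have h2 := hFi i
      have h3 : m * (18 / 100 * γ) ≤ ∑ j, F i (ω j) := by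
        refine le_trans ?_ h1.le
        apply mul_le_mul_of_nonneg_left _ hmp.le
        linarith
      calc s * γ / 4 ≤ 2.2 / s * (m * (18 / 100 * γ)) := by
            rw [← hss]
            have : 2.2 / s * (s * s * (18 / 100 * γ)) = 0.396 * (s * γ) := by
              field_simp; norm_num
            rw [this]
            have : 0 < s * γ := by positivity
            linarith
        _ ≤ _ := mul_le_mul_of_nonneg_left h3 (by positivity)
  have hbad : Q S'ᶜ ≤ ENNReal.ofReal δ := by
    calc Q S'ᶜ ≤ Q (⋃ i, B i) := measure_mono hsub
      _ ≤ ∑ i, Q (B i) := measure_iUnion_fintype_le _ _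
      _ ≤ ∑ i : Fin n, ENNReal.ofReal (δ / (2 * n)) := Finset.sum_le_sum fun i _ => hB i
      _ = ENNReal.ofReal (n * (δ / (2 * n))) := by
          rw [Finset.sum_const, Finset.card_univ, Fintype.card_fin, nsmul_eq_mul,
            ENNReal.ofReal_mul hnp.le, ENNReal.ofReal_natCast]
      _ ≤ ENNReal.ofReal δ := by
          apply ENNReal.ofReal_le_ofReal
          have : (n:ℝ) * (δ / (2 * n)) = δ / 2 := by field_simp
          rw [this]; linarith
  rw [ENNReal.ofReal_sub _ hδ.le, ENNReal.ofReal_one, tsub_le_iff_right]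
  calc (1 : ℝ≥0∞) = Q Set.univ := measure_univ.symm
    _ = Q (S' ∪ S'ᶜ) := by rw [Set.union_compl_self]
    _ ≤ Q S' + Q S'ᶜ := measure_union_le _ _
    _ ≤ _ := by gcongr
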